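/- arXiv:math/0407019 — 2 statements merged into one kernel-verified Lean document; each statement's English description precedes it below -/
import Mathlib

section
/- Let 𝒜 be a preadditive category, (C•,d_C) and (D•,d_D) cochain complexes in 𝒜, f : C• → D• and g : D• → C• cochain maps of degree 0, and H : g∘f → 1_{C•}, K : f∘g → 1_{D•} homotopies (δ(H) = 1 − g∘f, δ(K) = 1 − f∘g). Define K′ = K + f∘(H∘g − g∘K). Then K′ is again a homotopy f∘g → 1_{D•}, and there exists a graded map z : D• → C• of degree −2 with H∘g − g∘K′ = δ(z); that is, the class [Hg − gK′] vanishes in H^{−1} of the Hom-complex Hom•(D•,C•). -/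
open CategoryTheory

namespace Paper

/-- A graded object: a `ℤ`-indexed family of objects. -/
abbrev GradedObj (A : Type*) [Category A] := ℤ → A

/-- A graded map of degree `n` from `X` to `Y`. -/
abbrev GMap {A : Type*} [Category A] (X Y : GradedObj A) (n : ℤ) :=
  ∀ i : ℤ, X i ⟶ Y (i + n)

/-- Composition of graded maps, in diagrammatic order (`gcomp h f g` is "`g ∘ f`"),
with prescribed total degree `k = n + m`. -/
def gcomp {A : Type*} [Category A] {X Y Z : GradedObj A} {n m k : ℤ} (h : n + m = k)
    (f : GMap X Y n) (g : GMap Y Z m) : GMap X Z k :=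
  fun i => f i ≫ g (i + n) ≫ eqToHom (congrArg Z (show i + n + m = i + k by omega))

/-- The identity graded map of degree `0`. -/
def gid {A : Type*} [Category A] (X : GradedObj A) : GMap X X 0 :=
  fun i => eqToHom (congrArg X (add_zero i).symm)

/-- `δ(f) = d_Y ∘ f - (-1)ⁿ ⬝ f ∘ d_X` for pre-differentials `d_X`, `d_Y` and a graded
map `f` of degree `n`; the result has degree `m = n + 1`. -/
def gdelta {A : Type*} [Category A] [Preadditive A] {X Y : GradedObj A}
    (dX : GMap X X 1) (dY : GMap Y Y 1) {n m : ℤ} (h : n + 1 = m) (f : GMap X Y n) :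
    GMap X Y m :=
  gcomp h f dY - (n.negOnePow : ℤ) • gcomp (show 1 + n = m by omega) dX f

/-- The image of a graded object under a functor. -/
abbrev Fgr {A B : Type*} [Category A] [Category B] (F : B ⥤ A) (X : GradedObj B) :
    GradedObj A := fun i => F.obj (X i)

/-- The image of a graded map under a functor. -/
def Fmap {A B : Type*} [Category A] [Category B] (F : B ⥤ A) {X Y : GradedObj B} {n : ℤ}
    (f : GMap X Y n) : GMap (Fgr F X) (Fgr F Y) n := fun i => F.map (f i)

/-- `Ker(F)² = 0`: the composite of two `F`-killed morphisms vanishes. -/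
def KerSq {A B : Type*} [Category A] [Category B] [Preadditive A] [Preadditive B]
    (F : B ⥤ A) : Prop :=
  ∀ ⦃X Y Z : B⦄ (u : X ⟶ Y) (v : Y ⟶ Z), F.map u = 0 → F.map v = 0 → u ≫ v = 0

/-- `f : (X,dX) → (Y,dY)` and `g : (Y,dY) → (X,dX)` are cochain maps which are homotopy
inverse to each other. -/
def IsHomotopyEquivPair {A : Type*} [Category A] [Preadditive A] {X Y : GradedObj A}
    (dX : GMap X X 1) (dY : GMap Y Y 1) (f : GMap X Y 0) (g : GMap Y X 0) : Prop :=
  gdelta dX dY (show (0:ℤ) + 1 = 1 by omega) f = 0 ∧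
  gdelta dY dX (show (0:ℤ) + 1 = 1 by omega) g = 0 ∧
  (∃ H : GMap X X (-1), gdelta dX dX (show (-1:ℤ) + 1 = 0 by omega) H
      = gid X - gcomp (show (0:ℤ) + 0 = 0 by omega) f g) ∧
  (∃ K : GMap Y Y (-1), gdelta dY dY (show (-1:ℤ) + 1 = 0 by omega) K
      = gid Y - gcomp (show (0:ℤ) + 0 = 0 by omega) g f)

section GradedMaps

variable {A : Type*} [Category A]

theorem GMap.eqToHom_comp {X Y : GradedObj A} {n : ℤ} (f : GMap X Y n) {i j : ℤ} (h : i = j) :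
    eqToHom (congrArg X h) ≫ f j =
      f i ≫ eqToHom (congrArg Y (show i + n = j + n by rw [h])) := by
  subst h
  simp

theorem gcomp_assoc {X Y Z W : GradedObj A} {n m p k l q : ℤ}
    (h : n + m = k) (h' : m + p = l) (hq : k + p = q) (hq' : n + l = q)
    (f : GMap X Y n) (g : GMap Y Z m) (e : GMap Z W p) :
    gcomp hq (gcomp h f g) e = gcomp hq' f (gcomp h' g e) := by
  funext i
  have := GMap.eqToHom_comp e (show i + n + m = i + k by omega)
  simp only [gcomp, Category.assoc, reassoc_of% this, eqToHom_trans]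

theorem gcomp_gid {X Y : GradedObj A} {n : ℤ} (h : n + 0 = n) (f : GMap X Y n) :
    gcomp h f (gid Y) = f := by
  funext i
  simp [gcomp, gid]

theorem gid_gcomp {X Y : GradedObj A} {n : ℤ} (h : 0 + n = n) (f : GMap X Y n) :
    gcomp h (gid X) f = f := by
  funext i
  have := GMap.eqToHom_comp f (show i = i + 0 by omega)
  simp only [gcomp, gid, reassoc_of% this, eqToHom_trans, eqToHom_refl, Category.comp_id]

variable [Preadditive A]

theorem gcomp_add {X Y Z : GradedObj A} {n m k : ℤ} (h : n + m = k)
    (f : GMap X Y n) (g g' : GMap Y Z m) :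
    gcomp h f (g + g') = gcomp h f g + gcomp h f g' := by
  funext i
  simp [gcomp]

theorem gcomp_sub {X Y Z : GradedObj A} {n m k : ℤ} (h : n + m = k)
    (f : GMap X Y n) (g g' : GMap Y Z m) :
    gcomp h f (g - g') = gcomp h f g - gcomp h f g' := by
  funext i
  simp [gcomp]

theorem gcomp_zsmul {X Y Z : GradedObj A} {n m k : ℤ} (h : n + m = k) (a : ℤ)
    (f : GMap X Y n) (g : GMap Y Z m) :
    gcomp h f (a • g) = a • gcomp h f g := by
  funext i
  simp [gcomp]

theorem gcomp_zero {X Y Z : GradedObj A} {n m k : ℤ} (h : n + m = k)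
    (f : GMap X Y n) : gcomp h f (0 : GMap Y Z m) = 0 := by
  funext i
  simp [gcomp]

theorem add_gcomp {X Y Z : GradedObj A} {n m k : ℤ} (h : n + m = k)
    (f f' : GMap X Y n) (g : GMap Y Z m) :
    gcomp h (f + f') g = gcomp h f g + gcomp h f' g := by
  funext i
  simp [gcomp]

theorem sub_gcomp {X Y Z : GradedObj A} {n m k : ℤ} (h : n + m = k)
    (f f' : GMap X Y n) (g : GMap Y Z m) :
    gcomp h (f - f') g = gcomp h f g - gcomp h f' g := by
  funext i
  simp [gcomp]

theorem zsmul_gcomp {X Y Z : GradedObj A} {n m k : ℤ} (h : n + m = k) (a : ℤ)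
    (f : GMap X Y n) (g : GMap Y Z m) :
    gcomp h (a • f) g = a • gcomp h f g := by
  funext i
  simp [gcomp]

theorem zero_gcomp {X Y Z : GradedObj A} {n m k : ℤ} (h : n + m = k)
    (g : GMap Y Z m) : gcomp h (0 : GMap X Y n) g = 0 := by
  funext i
  simp [gcomp]

theorem gdelta_add {X Y : GradedObj A} (dX : GMap X X 1) (dY : GMap Y Y 1) {n m : ℤ}
    (h : n + 1 = m) (f g : GMap X Y n) :
    gdelta dX dY h (f + g) = gdelta dX dY h f + gdelta dX dY h g := by
  simp only [gdelta, add_gcomp, gcomp_add, smul_add]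
  abel

theorem gdelta_sub {X Y : GradedObj A} (dX : GMap X X 1) (dY : GMap Y Y 1) {n m : ℤ}
    (h : n + 1 = m) (f g : GMap X Y n) :
    gdelta dX dY h (f - g) = gdelta dX dY h f - gdelta dX dY h g := by
  simp only [gdelta, sub_gcomp, gcomp_sub, smul_sub]
  abel

/-- The Leibniz rule `δ(g ∘ f) = δ(g) ∘ f + (-1)ᵐ g ∘ δ(f)` for `g` of degree `m`. -/
theorem gdelta_gcomp {X Y Z : GradedObj A} (dX : GMap X X 1) (dY : GMap Y Y 1)
    (dZ : GMap Z Z 1) {n m k n' m' k' : ℤ} (h : n + m = k) (hn : n + 1 = n')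
    (hm : m + 1 = m') (hk : k + 1 = k') (h₁ : n + m' = k') (h₂ : n' + m = k')
    (f : GMap X Y n) (g : GMap Y Z m) :
    gdelta dX dZ hk (gcomp h f g) =
      gcomp h₁ f (gdelta dY dZ hm g) +
        (m.negOnePow : ℤ) • gcomp h₂ (gdelta dX dY hn f) g := by
  have hsign : (k.negOnePow : ℤ) = (m.negOnePow : ℤ) * (n.negOnePow : ℤ) := by
    rw [← h, Int.negOnePow_add, Units.val_mul, mul_comm]
  simp only [gdelta, gcomp_sub, gcomp_zsmul, sub_gcomp, zsmul_gcomp, smul_sub, smul_smul, hsign]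
  rw [gcomp_assoc h hm hk h₁, gcomp_assoc hn (show 1 + m = m' by omega) h₂ h₁,
    gcomp_assoc (show 1 + n = n' by omega) h h₂ (show 1 + k = k' by omega)]
  abel

end GradedMaps

/-- Markl's trick, Theorem `comp2`(3): replacing `K` by
`K′ = K + f∘(H∘g − g∘K)` yields again a homotopy `f∘g → 1`, for which the class
`[Hg − gK′]` vanishes in `H⁻¹Hom•(D,C)`. -/
theorem statement9 {A : Type*} [Category A] [Preadditive A]
    (X Y : GradedObj A)
    (dX : GMap X X 1) (dY : GMap Y Y 1)
    (hdX : gcomp (show (1:ℤ) + 1 = 2 by omega) dX dX = 0)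
    (hdY : gcomp (show (1:ℤ) + 1 = 2 by omega) dY dY = 0)
    (f : GMap X Y 0) (g : GMap Y X 0)
    (hf : gdelta dX dY (show (0:ℤ) + 1 = 1 by omega) f = 0)
    (hg : gdelta dY dX (show (0:ℤ) + 1 = 1 by omega) g = 0)
    (H : GMap X X (-1))
    (hH : gdelta dX dX (show (-1:ℤ) + 1 = 0 by omega) H
      = gid X - gcomp (show (0:ℤ) + 0 = 0 by omega) f g)
    (K : GMap Y Y (-1))
    (hK : gdelta dY dY (show (-1:ℤ) + 1 = 0 by omega) K
      = gid Y - gcomp (show (0:ℤ) + 0 = 0 by omega) g f) :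
    gdelta dY dY (show (-1:ℤ) + 1 = 0 by omega)
      (K + gcomp (show (-1:ℤ) + 0 = -1 by omega)
        (gcomp (show (0:ℤ) + -1 = -1 by omega) g H
          - gcomp (show (-1:ℤ) + 0 = -1 by omega) K g) f)
      = gid Y - gcomp (show (0:ℤ) + 0 = 0 by omega) g f ∧
    ∃ z : GMap Y X (-2),
      gcomp (show (0:ℤ) + -1 = -1 by omega) g H
        - gcomp (show (-1:ℤ) + 0 = -1 by omega)
            (K + gcomp (show (-1:ℤ) + 0 = -1 by omega)
              (gcomp (show (0:ℤ) + -1 = -1 by omega) g H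
                - gcomp (show (-1:ℤ) + 0 = -1 by omega) K g) f) g
      = gdelta dY dX (show (-2:ℤ) + 1 = -1 by omega) z := by
  set W : GMap Y X (-1) := gcomp (show (0:ℤ) + -1 = -1 by omega) g H
    - gcomp (show (-1:ℤ) + 0 = -1 by omega) K g with hW_def
  have hW : gdelta dY dX (show (-1:ℤ) + 1 = 0 by omega) W = 0 := by
    rw [hW_def, gdelta_sub,
      gdelta_gcomp dY dX dX _ (show (0:ℤ) + 1 = 1 by omega) (show (-1:ℤ) + 1 = 0 by omega) _
        (show (0:ℤ) + 0 = 0 by omega) (show (1:ℤ) + -1 = 0 by omega),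
      gdelta_gcomp dY dY dX _ (show (-1:ℤ) + 1 = 0 by omega) (show (0:ℤ) + 1 = 1 by omega) _
        (show (-1:ℤ) + 1 = 0 by omega) (show (0:ℤ) + 0 = 0 by omega),
      hg, hH, hK]
    simp only [zero_gcomp, gcomp_zero, smul_zero, gcomp_sub, sub_gcomp, gcomp_gid, gid_gcomp,
      Int.negOnePow_zero, Units.val_one, one_smul]
    rw [gcomp_assoc (show (0:ℤ) + 0 = 0 by omega) (show (0:ℤ) + 0 = 0 by omega)
      (show (0:ℤ) + 0 = 0 by omega) (show (0:ℤ) + 0 = 0 by omega) g f g]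
    abel
  refine ⟨?_, gcomp (show (-1:ℤ) + -1 = -2 by omega) W H, ?_⟩
  · rw [gdelta_add, hK,
      gdelta_gcomp dY dX dY _ (show (-1:ℤ) + 1 = 0 by omega) (show (0:ℤ) + 1 = 1 by omega) _
        (show (-1:ℤ) + 1 = 0 by omega) (show (0:ℤ) + 0 = 0 by omega),
      hf, hW]
    simp only [zero_gcomp, gcomp_zero, smul_zero, add_zero]
  · rw [gdelta_gcomp dY dX dX _ (show (-1:ℤ) + 1 = 0 by omega) (show (-1:ℤ) + 1 = 0 by omega) _
        (show (-1:ℤ) + 0 = -1 by omega) (show (0:ℤ) + -1 = -1 by omega),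
      hW, hH, add_gcomp,
      gcomp_assoc (show (-1:ℤ) + 0 = -1 by omega) (show (0:ℤ) + 0 = 0 by omega)
        (show (-1:ℤ) + 0 = -1 by omega) (show (-1:ℤ) + 0 = -1 by omega) W f g,
      ← sub_sub, ← hW_def]
    simp only [zero_gcomp, smul_zero, add_zero, gcomp_sub, gcomp_gid]


end Paper
end

section
/- Let (C•,d_C), (D•,d_D) be cochain complexes in 𝒞 and let f : C• → D•, g : D• → C• be cochain maps which are homotopy inverse to each other (there exist homotopies g∘f → 1_{C•} and f∘g → 1_{D•}). Let (C̄•,d̄_C) and (D̄•,d̄_D) be cochain complexes in 𝒞̄ lifting (C•,d_C) and (D•,d_D) (graded lifts C̄•, D̄• with F(d̄_C) = d_C, F(d̄_D) = d_D). Then for every cochain map f̄ : (C̄•,d̄_C) → (D̄•,d̄_D) with F(f̄) = f there exists a cochain map ḡ : (D̄•,d̄_D) → (C̄•,d̄_C) with F(ḡ) = g such that f̄ and ḡ are homotopy inverse to each other; in particular every such f̄ is a homotopy equivalence. -/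
open CategoryTheory

namespace Paper

section Cochains

open CochainComplex CochainComplex.HomComplex

variable {A B : Type*} [Category A] [Preadditive A] [Category B] [Preadditive B]
  {K L M : CochainComplex B ℤ}

/-- In the dg category of cochain complexes, composites of two cochains killed by `F` vanish
as soon as `Ker(F)² = 0`. -/
lemma KerSq.comp_eq_zero {F : B ⥤ A} [F.Additive] (hF : KerSq F) {n m k : ℤ}
    {u : Cochain K L n} {v : Cochain L M m} (hu : u.map F = 0) (hv : v.map F = 0)
    (h : n + m = k) : u.comp v h = 0 := by
  ext p q hpq
  rw [Cochain.comp_v u v h p _ q rfl (by omega)]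
  exact hF _ _ (Cochain.congr_v hu _ _ _) (Cochain.congr_v hv _ _ _)

/-- If `f` is closed and `g` is an inverse of `f` up to homotopy and up to cochains killed
by `F`, then `g` can be corrected by a cochain killed by `F` to a closed cochain. -/
lemma exists_closed_correction {F : B ⥤ A} [F.Additive] (hF : KerSq F)
    {f : Cochain K L 0} (hf : δ 0 1 f = 0) {g : Cochain L K 0} (hg : (δ 0 1 g).map F = 0)
    {H : Cochain K K (-1)} {l : Cochain K K 0} (hl : l.map F = 0)
    (hH : δ (-1) 0 H = Cochain.ofHom (𝟙 K) - f.comp g (add_zero 0) + l)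
    {H' : Cochain L L (-1)} {k : Cochain L L 0} (hk : k.map F = 0)
    (hH' : δ (-1) 0 H' = Cochain.ofHom (𝟙 L) - g.comp f (add_zero 0) + k) :
    ∃ g' : Cochain L K 0, δ 0 1 g' = 0 ∧ (g' - g).map F = 0 := by
  have hδk : δ 0 1 k = (δ 0 1 g).comp f (add_zero 1) := by
    have h := congrArg (δ 0 1) hH'
    rw [δ_δ, δ_add, δ_sub, δ_ofHom, δ_comp_zero_cochain _ _ _ (zero_add 1), hf,
      Cochain.comp_zero, zero_add, zero_sub, eq_comm, neg_add_eq_zero] at h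
    exact h.symm
  have hδkg : δ 0 1 (k.comp g (add_zero 0)) =
      (δ 0 1 g).comp (f.comp g (add_zero 0)) (add_zero 1) := by
    rw [δ_comp_zero_cochain _ _ _ (zero_add 1), hF.comp_eq_zero hk hg, zero_add, hδk,
      Cochain.comp_assoc_of_third_is_zero_cochain]
  have hδaH : δ 0 1 ((δ 0 1 g).comp H (show (1 : ℤ) + -1 = 0 by omega)) =
      δ 0 1 g - (δ 0 1 g).comp (f.comp g (add_zero 0)) (add_zero 1) := by
    rw [δ_comp _ _ _ 2 0 1 (by omega) (by omega) (by omega), δ_δ, Cochain.zero_comp, smul_zero,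
      add_zero, hH, Cochain.comp_add, Cochain.comp_sub, Cochain.comp_id,
      hF.comp_eq_zero hg hl, add_zero]
  refine ⟨g - (δ 0 1 g).comp H (show (1 : ℤ) + -1 = 0 by omega) - k.comp g (add_zero 0), ?_, ?_⟩
  · rw [δ_sub, δ_sub, hδkg, hδaH]
    abel
  · simp [hg, hk]

/-- A closed cochain `g` which is inverse to the closed cochain `f` up to homotopy and up to
cochains killed by `F` can be corrected to a homotopy inverse of `f`. -/
lemma exists_homotopyInverse_correction {F : B ⥤ A} [F.Additive] (hF : KerSq F)
    {f : Cochain K L 0} (hf : δ 0 1 f = 0) {g : Cochain L K 0} (hg : δ 0 1 g = 0)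
    {H : Cochain K K (-1)} {l : Cochain K K 0} (hl : l.map F = 0)
    (hH : δ (-1) 0 H = Cochain.ofHom (𝟙 K) - f.comp g (add_zero 0) + l)
    {H' : Cochain L L (-1)} {k : Cochain L L 0} (hk : k.map F = 0)
    (hH' : δ (-1) 0 H' = Cochain.ofHom (𝟙 L) - g.comp f (add_zero 0) + k) :
    ∃ g' : Cochain L K 0, δ 0 1 g' = 0 ∧ (g' - g).map F = 0 ∧
      (∃ H, δ (-1) 0 H = Cochain.ofHom (𝟙 K) - f.comp g' (add_zero 0)) ∧
      ∃ H', δ (-1) 0 H' = Cochain.ofHom (𝟙 L) - g'.comp f (add_zero 0) := by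
  have hδl : δ 0 1 l = 0 := by
    have h := congrArg (δ 0 1) hH
    rw [δ_δ, δ_add, δ_sub, δ_ofHom, δ_comp_zero_cochain _ _ _ (zero_add 1), hf, hg,
      Cochain.comp_zero, Cochain.zero_comp] at h
    simpa using h.symm
  have hδk : δ 0 1 k = 0 := by
    have h := congrArg (δ 0 1) hH'
    rw [δ_δ, δ_add, δ_sub, δ_ofHom, δ_comp_zero_cochain _ _ _ (zero_add 1), hf, hg,
      Cochain.comp_zero, Cochain.zero_comp] at h
    simpa using h.symm
  have hll : l.comp l (add_zero 0) = 0 := hF.comp_eq_zero hl hl _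
  have hkk : k.comp k (add_zero 0) = 0 := hF.comp_eq_zero hk hk _
  have hfg : f.comp g (add_zero 0) = Cochain.ofHom (𝟙 K) + l - δ (-1) 0 H := by
    rw [hH]; abel
  have hgf : g.comp f (add_zero 0) = Cochain.ofHom (𝟙 L) + k - δ (-1) 0 H' := by
    rw [hH']; abel
  have hcomm : δ (-1) 0 (g.comp H (zero_add _) - H'.comp g (add_zero _)) =
      g.comp l (add_zero 0) - k.comp g (add_zero 0) := by
    rw [δ_sub, δ_zero_cochain_comp _ _ _ (by omega), δ_comp_zero_cochain _ _ _ (by omega), hg, hH,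
      hH']
    simp
  refine ⟨g - k.comp g (add_zero 0), ?_, ?_,
    ⟨H - H.comp l (add_zero _) -
      f.comp (g.comp H (zero_add _) - H'.comp g (add_zero _)) (zero_add _), ?_⟩,
    ⟨H' - k.comp H' (zero_add _), ?_⟩⟩
  · rw [δ_sub, δ_comp_zero_cochain _ _ _ (zero_add 1), hg, hδk]
    simp
  · simp [hk]
  · rw [δ_sub, δ_sub, δ_comp_zero_cochain _ _ _ (by omega), hδl,
      δ_zero_cochain_comp f _ _ (by omega), hf, hcomm, hH]
    simp [hll]
    abel
  · rw [δ_sub, δ_zero_cochain_comp _ _ _ (by omega), hδk, hH']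
    simp [hkk]
    abel

/-- The cochain attached to a graded map. -/
def toCochain {n : ℤ} (f : GMap K.X L.X n) : Cochain K L n :=
  Cochain.mk fun p _ hpq => f p ≫ eqToHom (congrArg L.X hpq)

/-- The graded map attached to a cochain. -/
def ofCochain {n : ℤ} (z : Cochain K L n) : GMap K.X L.X n := fun i => z.v i (i + n) rfl

/-- The differential of a complex as a graded map. -/
def gd (K : CochainComplex B ℤ) : GMap K.X K.X 1 := fun i => K.d i (i + 1)

lemma ofCochain_v {n : ℤ} (z : Cochain K L n) (p q : ℤ) (hpq : p + n = q) :
    z.v p q hpq = ofCochain z p ≫ eqToHom (congrArg L.X hpq) := by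
  subst hpq
  simp [ofCochain]

@[simp]
lemma ofCochain_toCochain {n : ℤ} (f : GMap K.X L.X n) : ofCochain (toCochain f) = f := by
  funext i
  simp [ofCochain, toCochain]

lemma ofCochain_injective {n : ℤ} :
    Function.Injective (ofCochain : Cochain K L n → GMap K.X L.X n) := fun z z' h => by
  ext p q hpq
  rw [ofCochain_v, ofCochain_v, h]

@[simp]
lemma ofCochain_zero {n : ℤ} : ofCochain (0 : Cochain K L n) = 0 := rfl

@[simp]
lemma ofCochain_sub {n : ℤ} (z z' : Cochain K L n) :
    ofCochain (z - z') = ofCochain z - ofCochain z' := rfl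

@[simp]
lemma ofCochain_id : ofCochain (Cochain.ofHom (𝟙 K)) = gid K.X := by
  funext i
  have h : ∀ (q : ℤ) (hq : i + 0 = q), (Cochain.ofHom (𝟙 K)).v i q hq =
      eqToHom (congrArg K.X ((add_zero i).symm.trans hq)) := by
    intro q hq
    obtain rfl : i = q := by omega
    simp
  exact h _ rfl

@[simp]
lemma ofCochain_comp {n m k : ℤ} (z : Cochain K L n) (z' : Cochain L M m) (h : n + m = k) :
    ofCochain (z.comp z' h) = gcomp h (ofCochain z) (ofCochain z') := by
  funext i
  rw [ofCochain, Cochain.comp_v z z' h i (i + n) (i + k) rfl (by omega), ofCochain_v z']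
  rfl

lemma gd_comp_eqToHom (p q : ℤ) (h : p + 1 = q) :
    gd K p ≫ eqToHom (congrArg K.X h) = K.d p q := by
  subst h
  simp [gd]

lemma ofCochain_δ {n m : ℤ} (h : n + 1 = m) (z : Cochain K L n) :
    ofCochain (δ n m z) = gdelta (gd K) (gd L) h (ofCochain z) := by
  funext i
  have hd : (i + 1) + n = i + m := by omega
  rw [ofCochain, δ_v n m h z i (i + m) rfl (i + n) (i + 1) (by omega) rfl]
  subst h
  rw [Int.negOnePow_succ, Units.neg_smul, ← sub_eq_add_neg, ofCochain_v z (i + 1) _ hd,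
    ← gd_comp_eqToHom (i + n) (i + (n + 1)) (by omega)]
  rfl

end Cochains

section Functor

variable {A B : Type*} [Category A] [Category B]

lemma Fmap_gcomp (F : B ⥤ A) {X Y Z : GradedObj B} {n m k : ℤ} (h : n + m = k)
    (f : GMap X Y n) (g : GMap Y Z m) :
    Fmap F (gcomp h f g) = gcomp h (Fmap F f) (Fmap F g) := by
  funext i
  simp [Fmap, gcomp, eqToHom_map]

lemma Fmap_gid (F : B ⥤ A) (X : GradedObj B) : Fmap F (gid X) = gid (Fgr F X) := by
  funext i
  simp [Fmap, gid, eqToHom_map]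

lemma exists_Fmap_eq (F : B ⥤ A) [F.Full] {X Y : GradedObj B} {n : ℤ}
    (f : GMap (Fgr F X) (Fgr F Y) n) : ∃ f' : GMap X Y n, Fmap F f' = f :=
  ⟨fun i => F.preimage (f i), funext fun _ => F.map_preimage _⟩

variable [Preadditive A] [Preadditive B]

lemma Fmap_sub (F : B ⥤ A) [F.Additive] {X Y : GradedObj B} {n : ℤ} (f g : GMap X Y n) :
    Fmap F (f - g) = Fmap F f - Fmap F g :=
  funext fun _ => F.map_sub

lemma Fmap_gdelta (F : B ⥤ A) [F.Additive] {X Y : GradedObj B} (dX : GMap X X 1)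
    (dY : GMap Y Y 1) {n m : ℤ} (h : n + 1 = m) (f : GMap X Y n) :
    Fmap F (gdelta dX dY h f) = gdelta (Fmap F dX) (Fmap F dY) h (Fmap F f) := by
  rw [gdelta, gdelta, Fmap_sub, ← Fmap_gcomp, ← Fmap_gcomp]
  congr 1
  funext i
  exact F.map_zsmul

open CochainComplex CochainComplex.HomComplex

lemma map_eq_zero_iff_Fmap_ofCochain (F : B ⥤ A) [F.Additive] {K L : CochainComplex B ℤ} {n : ℤ}
    (z : Cochain K L n) : z.map F = 0 ↔ Fmap F (ofCochain z) = 0 := by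
  refine ⟨fun h => funext fun i => Cochain.congr_v h i _ rfl, fun h => ?_⟩
  ext p q hpq
  have hp : F.map (ofCochain z p) = 0 := congrFun h p
  rw [Cochain.map_v, ofCochain_v, F.map_comp, hp, Limits.zero_comp]
  rfl

lemma isHomotopyEquivPair_iff {K L : CochainComplex B ℤ} (f : Cochain K L 0) (g : Cochain L K 0) :
    IsHomotopyEquivPair (gd K) (gd L) (ofCochain f) (ofCochain g) ↔
      δ 0 1 f = 0 ∧ δ 0 1 g = 0 ∧
      (∃ H, δ (-1) 0 H = Cochain.ofHom (𝟙 K) - f.comp g (add_zero 0)) ∧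
      ∃ H', δ (-1) 0 H' = Cochain.ofHom (𝟙 L) - g.comp f (add_zero 0) := by
  have hs : ∀ {K L : CochainComplex B ℤ},
      Function.Surjective (ofCochain : Cochain K L (-1) → GMap K.X L.X (-1)) :=
    fun f => ⟨toCochain f, ofCochain_toCochain f⟩
  simp only [IsHomotopyEquivPair, hs.exists, ← ofCochain_δ, ← ofCochain_comp, ← ofCochain_id,
    ← ofCochain_sub, ofCochain_injective.eq_iff, ← ofCochain_zero]

/-- Lifting of homotopy inverses, for bundled cochain complexes. -/
lemma exists_lift_homotopyInverse (F : B ⥤ A) [F.Additive] [F.Full] (hF : KerSq F)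
    (K L : CochainComplex B ℤ) (f : GMap K.X L.X 0) (hf : gdelta (gd K) (gd L) (zero_add 1) f = 0)
    (g : GMap (Fgr F L.X) (Fgr F K.X) 0)
    (hfg : IsHomotopyEquivPair (Fmap F (gd K)) (Fmap F (gd L)) (Fmap F f) g) :
    ∃ g' : GMap L.X K.X 0, Fmap F g' = g ∧ IsHomotopyEquivPair (gd K) (gd L) f g' := by
  obtain ⟨-, hg, ⟨H, hH⟩, ⟨H', hH'⟩⟩ := hfg
  obtain ⟨g, rfl⟩ := exists_Fmap_eq F g
  obtain ⟨H, rfl⟩ := exists_Fmap_eq F H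
  obtain ⟨H', rfl⟩ := exists_Fmap_eq F H'
  rw [← ofCochain_toCochain f, ← ofCochain_toCochain g] at *
  rw [← ofCochain_toCochain H] at hH
  rw [← ofCochain_toCochain H'] at hH'
  generalize toCochain f = f at *
  generalize toCochain g = g at *
  generalize toCochain H = H at *
  generalize toCochain H' = H' at *
  rw [← ofCochain_δ, ← ofCochain_zero, ofCochain_injective.eq_iff] at hf
  rw [← Fmap_gdelta, ← ofCochain_δ, ← map_eq_zero_iff_Fmap_ofCochain] at hg
  rw [← Fmap_gdelta, ← Fmap_gcomp, ← Fmap_gid, ← Fmap_sub, ← sub_eq_zero, ← Fmap_sub,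
    ← ofCochain_δ, ← ofCochain_comp, ← ofCochain_id, ← ofCochain_sub, ← ofCochain_sub,
    ← map_eq_zero_iff_Fmap_ofCochain] at hH hH'
  obtain ⟨g₁, hg₁, hgg₁⟩ := exists_closed_correction hF hf hg hH (add_sub_cancel _ _).symm hH'
    (add_sub_cancel _ _).symm
  obtain ⟨g₂, hg₂, hgg₂, h, h'⟩ := exists_homotopyInverse_correction hF hf hg₁
    (l := δ (-1) 0 H - (Cochain.ofHom (𝟙 K) - f.comp g₁ (add_zero 0))) (by
      have : δ (-1) 0 H - (Cochain.ofHom (𝟙 K) - f.comp g₁ (add_zero 0)) =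
        δ (-1) 0 H - (Cochain.ofHom (𝟙 K) - f.comp g (add_zero 0)) +
          f.comp (g₁ - g) (add_zero 0) := by
        rw [Cochain.comp_sub]; abel
      rw [this, Cochain.map_add, hH, Cochain.map_comp, hgg₁, Cochain.comp_zero, add_zero])
    (add_sub_cancel _ _).symm
    (k := δ (-1) 0 H' - (Cochain.ofHom (𝟙 L) - g₁.comp f (add_zero 0))) (by
      have : δ (-1) 0 H' - (Cochain.ofHom (𝟙 L) - g₁.comp f (add_zero 0)) =
        δ (-1) 0 H' - (Cochain.ofHom (𝟙 L) - g.comp f (add_zero 0)) +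
          (g₁ - g).comp f (add_zero 0) := by
        rw [Cochain.sub_comp]; abel
      rw [this, Cochain.map_add, hH', Cochain.map_comp, hgg₁, Cochain.zero_comp, add_zero])
    (add_sub_cancel _ _).symm
  refine ⟨ofCochain g₂, ?_, (isHomotopyEquivPair_iff _ _).2 ⟨hf, hg₂, h, h'⟩⟩
  rw [← sub_eq_zero, ← Fmap_sub, ← ofCochain_sub, ← map_eq_zero_iff_Fmap_ofCochain,
    ← sub_add_sub_cancel g₂ g₁ g, Cochain.map_add, hgg₁, hgg₂, add_zero]

lemma comp_eq_zero_of_gcomp_eq_zero {X : GradedObj B} {d : GMap X X 1} {n : ℤ}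
    {hn : 1 + 1 = n} (h : gcomp hn d d = 0) (i : ℤ) : d i ≫ d (i + 1) = 0 := by
  have hi := congrFun h i
  rw [gcomp, ← Category.assoc] at hi
  exact (Preadditive.IsIso.comp_right_eq_zero _ _).1 hi

lemma gd_of {X : GradedObj B} (d : GMap X X 1) (h : ∀ i, d i ≫ d (i + 1) = 0) :
    gd (CochainComplex.of X d h) = d :=
  funext fun i => CochainComplex.of_d X d i

end Functor

/-- crude lifting lemma, Corollary `crude`(2): if `f` and `g` are homotopy
inverse cochain maps and `(C̄,d̄_C)`, `(D̄,d̄_D)` are lifted complexes, then every cochain-map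
lift `f̄` of `f` admits a cochain-map lift `ḡ` of `g` which is homotopy inverse to it; in
particular `f̄` is a homotopy equivalence. -/
theorem statement11 {B C : Type*} [Category B] [Preadditive B] [Category C] [Preadditive C]
    (F : B ⥤ C) [F.Additive] [F.Full] (hF : KerSq F)
    (Xb Yb : GradedObj B)
    (dC : GMap (Fgr F Xb) (Fgr F Xb) 1) (dD : GMap (Fgr F Yb) (Fgr F Yb) 1)
    (hdC : gcomp (show (1:ℤ) + 1 = 2 by omega) dC dC = 0)
    (hdD : gcomp (show (1:ℤ) + 1 = 2 by omega) dD dD = 0)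
    (f : GMap (Fgr F Xb) (Fgr F Yb) 0) (g : GMap (Fgr F Yb) (Fgr F Xb) 0)
    (hfg : IsHomotopyEquivPair dC dD f g)
    (dCb : GMap Xb Xb 1) (hdCb : Fmap F dCb = dC)
    (hdCbsq : gcomp (show (1:ℤ) + 1 = 2 by omega) dCb dCb = 0)
    (dDb : GMap Yb Yb 1) (hdDb : Fmap F dDb = dD)
    (hdDbsq : gcomp (show (1:ℤ) + 1 = 2 by omega) dDb dDb = 0)
    (fb : GMap Xb Yb 0) (hfb : Fmap F fb = f)
    (hfbc : gdelta dCb dDb (show (0:ℤ) + 1 = 1 by omega) fb = 0) :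
    ∃ gb : GMap Yb Xb 0, Fmap F gb = g ∧ IsHomotopyEquivPair dCb dDb fb gb := by
  subst hdCb hdDb hfb
  have hC := gd_of dCb (comp_eq_zero_of_gcomp_eq_zero hdCbsq)
  have hD := gd_of dDb (comp_eq_zero_of_gcomp_eq_zero hdDbsq)
  have := exists_lift_homotopyInverse F hF
    (CochainComplex.of Xb dCb (comp_eq_zero_of_gcomp_eq_zero hdCbsq))
    (CochainComplex.of Yb dDb (comp_eq_zero_of_gcomp_eq_zero hdDbsq)) fb
  rw [hC, hD] at this
  exact this hfbc g hfg

end Paper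
end
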